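/- (Bailey–Daum q-Kummer summation) For |q| < 1 and |q/a| < 1, one has ${}_2\phi_1(a, b; bq/a; q, -q/a) = \frac{(-q;q)_\infty (bq; q^2)_\infty (bq^2/a^2; q^2)_\infty}{(-q/a; q)_\infty (bq/a; q)_\infty}$. -/

import Mathlib

open Finset

noncomputable def qPoch (a q : ℂ) (n : ℕ) : ℂ := ∏ j ∈ Finset.range n, (1 - a * q ^ j)

noncomputable def qPochInf (a q : ℂ) : ℂ := ∏' j : ℕ, (1 - a * q ^ j)

noncomputable def phi (a b c q x : ℂ) : ℂ :=
  ∑' i : ℕ, qPoch a q i * qPoch b q i / (qPoch q q i * qPoch c q i) * x ^ i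
open Filter Topology

lemma qp_succ (a q : ℂ) (n : ℕ) : qPoch a q (n+1) = qPoch a q n * (1 - a * q^n) := by
  simp [qPoch, Finset.prod_range_succ]

lemma qp_zero (a q : ℂ) : qPoch a q 0 = 1 := by simp [qPoch]

lemma qp_succ' (a q : ℂ) (n : ℕ) : qPoch a q (n+1) = (1 - a) * qPoch (a*q) q n := by
  simp only [qPoch, Finset.prod_range_succ']
  rw [mul_comm]
  congr 1
  · simp
  · exact Finset.prod_congr rfl fun i _ => by ring

lemma qp_summable (a q : ℂ) (hq : ‖q‖ < 1) : Summable fun j : ℕ => ‖-(a * q^j)‖ := by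
  simp only [norm_neg, norm_mul, norm_pow]
  exact (summable_geometric_of_lt_one (norm_nonneg _) hq).mul_left _

lemma qp_tendsto (a q : ℂ) (hq : ‖q‖ < 1) :
    Tendsto (qPoch a q) atTop (𝓝 (qPochInf a q)) := by
  have h := (multipliable_one_add_of_summable (qp_summable a q hq)).hasProd.tendsto_prod_nat
  simp only [← sub_eq_add_neg] at h
  exact h

lemma qp_inf_succ (a q : ℂ) (hq : ‖q‖ < 1) :
    qPochInf a q = (1 - a) * qPochInf (a*q) q := by
  have h1 := (qp_tendsto a q hq).comp (tendsto_add_atTop_nat 1)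
  have h2 := (qp_tendsto (a*q) q hq).const_mul (1 - a)
  refine tendsto_nhds_unique h1 (h2.congr fun n => ?_)
  simp [qp_succ']

lemma qp_inf_split (a q : ℂ) (hq : ‖q‖ < 1) (n : ℕ) :
    qPochInf a q = qPoch a q n * qPochInf (a*q^n) q := by
  induction n with
  | zero => simp [qp_zero]
  | succ n ih =>
    rw [ih, qp_succ, qp_inf_succ (a*q^n) q hq, pow_succ]
    ring_nf

lemma qp_inf_ne (a q : ℂ) (hq : ‖q‖ < 1) (h : ∀ j : ℕ, a * q^j ≠ 1) : qPochInf a q ≠ 0 := by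
  have := tprod_one_add_ne_zero_of_summable (f := fun j : ℕ => -(a*q^j))
    (fun j => by rw [← sub_eq_add_neg]; exact sub_ne_zero.2 (h j).symm) (qp_summable a q hq)
  simp only [← sub_eq_add_neg] at this
  exact this

lemma qp_ne (a q : ℂ) (h : ∀ j : ℕ, a * q^j ≠ 1) (n : ℕ) : qPoch a q n ≠ 0 :=
  Finset.prod_ne_zero_iff.2 fun j _ => sub_ne_zero.2 (h j).symm

lemma small_ne (y q : ℂ) (hq : ‖q‖ < 1) (hy : ‖y‖ < 1) (j : ℕ) : y * q^j ≠ 1 := by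
  intro h
  have h1 : ‖y * q^j‖ = 1 := by rw [h]; simp
  rw [norm_mul, norm_pow] at h1
  have : ‖q‖^j ≤ 1 := pow_le_one₀ (norm_nonneg _) hq.le
  nlinarith [norm_nonneg y]

lemma qp_bound (q : ℂ) (hq : ‖q‖ < 1) (B : ℝ) (y : ℂ) (hy : ‖y‖ ≤ B) (n : ℕ) :
    ‖qPoch y q n‖ ≤ Real.exp (B * (1 - ‖q‖)⁻¹) := by
  have hB : 0 ≤ B := (norm_nonneg _).trans hy
  calc ‖qPoch y q n‖ ≤ ∏ j ∈ Finset.range n, Real.exp (B * ‖q‖^j) := by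
        rw [qPoch, norm_prod]
        refine Finset.prod_le_prod (fun _ _ => norm_nonneg _) fun j _ => ?_
        have h1 : ‖1 - y * q^j‖ ≤ 1 + ‖y‖ * ‖q‖^j := by
          refine (norm_sub_le _ _).trans ?_
          simp
        have h2 : ‖y‖ * ‖q‖^j ≤ B * ‖q‖^j := by gcongr
        have h3 := Real.add_one_le_exp (B * ‖q‖^j)
        linarith
    _ = Real.exp (B * ∑ j ∈ Finset.range n, ‖q‖^j) := by
        rw [← Real.exp_sum, Finset.mul_sum]
    _ ≤ _ := by
        gcongr
        rw [← tsum_geometric_of_lt_one (norm_nonneg _) hq]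
        exact (summable_geometric_of_lt_one (norm_nonneg _) hq).sum_le_tsum _ (fun _ _ => by positivity)

lemma qp_inf_bound (q : ℂ) (hq : ‖q‖ < 1) (B : ℝ) (y : ℂ) (hy : ‖y‖ ≤ B) :
    ‖qPochInf y q‖ ≤ Real.exp (B * (1 - ‖q‖)⁻¹) :=
  le_of_tendsto (qp_tendsto y q hq).norm (Eventually.of_forall fun n => qp_bound q hq B y hy n)

lemma qp_inv_bound (q : ℂ) (hq : ‖q‖ < 1) : ∃ K : ℝ, 0 ≤ K ∧ ∀ n, ‖(qPoch q q n)⁻¹‖ ≤ K := by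
  have h := (qp_tendsto q q hq).inv₀ (qp_inf_ne q q hq (small_ne q q hq hq))
  obtain ⟨K, hK⟩ := h.norm.bddAbove_range
  exact ⟨K, (norm_nonneg _).trans (hK ⟨0, rfl⟩), fun n => hK ⟨n, rfl⟩⟩

lemma qp_tail (c q : ℂ) (hq : ‖q‖ < 1) (hc : ∀ j : ℕ, c * q^j ≠ 1) :
    Tendsto (fun n : ℕ => qPochInf (c*q^n) q) atTop (𝓝 1) := by
  have hne := qp_inf_ne c q hq hc
  have h := (qp_tendsto c q hq).inv₀ hne |>.const_mul (qPochInf c q)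
  rw [mul_inv_cancel₀ hne] at h
  refine h.congr fun n => ?_
  rw [qp_inf_split c q hq n]
  have := qp_ne c q hc n
  field_simp

/-- terms of the q-binomial series -/
noncomputable def gT (a q x : ℂ) (i : ℕ) : ℂ := qPoch a q i * (qPoch q q i)⁻¹ * x^i

noncomputable def fT (a q x b : ℂ) (i : ℕ) : ℂ :=
  gT a q x i * (qPoch b q i * qPochInf (b*q/a*q^i) q)

lemma gT_bound (a q : ℂ) (hq : ‖q‖ < 1) :
    ∃ K : ℝ, 0 ≤ K ∧ ∀ (x : ℂ) (r : ℝ), ‖x‖ ≤ r → ∀ i, ‖gT a q x i‖ ≤ K * r^i := by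
  obtain ⟨K, hK0, hK⟩ := qp_inv_bound q hq
  refine ⟨Real.exp (‖a‖ * (1 - ‖q‖)⁻¹) * K, by positivity, fun x r hx i => ?_⟩
  rw [gT, norm_mul, norm_mul, norm_pow]
  have := qp_bound q hq ‖a‖ a le_rfl i
  have := hK i
  gcongr

lemma gT_summable (a q x : ℂ) (hq : ‖q‖ < 1) (hx : ‖x‖ < 1) : Summable (gT a q x) := by
  obtain ⟨K, hK0, hK⟩ := gT_bound a q hq
  exact Summable.of_norm_bounded ((summable_geometric_of_lt_one (norm_nonneg _) hx).mul_left K)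
    (hK x _ le_rfl)

lemma fT_bound (a q x b : ℂ) (hq : ‖q‖ < 1) :
    ∃ K : ℝ, 0 ≤ K ∧ ∀ m i : ℕ, ‖fT a q x (b*q^m) i‖ ≤ K * ‖x‖^i := by
  obtain ⟨K, hK0, hK⟩ := gT_bound a q hq
  refine ⟨K * (Real.exp (‖b‖ * (1 - ‖q‖)⁻¹) * Real.exp (‖b*q/a‖ * (1 - ‖q‖)⁻¹)),
    by positivity, fun m i => ?_⟩
  have hp : ∀ j, ‖q‖^j ≤ 1 := fun j => pow_le_one₀ (norm_nonneg _) hq.le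
  have h1 := qp_bound q hq ‖b‖ (b*q^m) (by
    rw [norm_mul, norm_pow]; exact mul_le_of_le_one_right (norm_nonneg _) (hp _)) i
  have h2 := qp_inf_bound q hq ‖b*q/a‖ (b*q^m*q/a*q^i) (by
    have : b*q^m*q/a*q^i = (b*q/a) * q^(m+i) := by ring
    rw [this, norm_mul, norm_pow]; exact mul_le_of_le_one_right (norm_nonneg _) (hp _))
  have h3 := hK x _ le_rfl i
  rw [fT, norm_mul, norm_mul]
  calc _ ≤ (K * ‖x‖^i) * (Real.exp (‖b‖ * (1 - ‖q‖)⁻¹) * Real.exp (‖b*q/a‖ * (1 - ‖q‖)⁻¹)) := by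
        gcongr
    _ = _ := by ring

lemma fT_summable (a q x b : ℂ) (hq : ‖q‖ < 1) (hx : ‖x‖ < 1) : Summable (fT a q x b) := by
  obtain ⟨K, hK0, hK⟩ := fT_bound a q x b hq
  refine Summable.of_norm_bounded ((summable_geometric_of_lt_one (norm_nonneg _) hx).mul_left K)
    fun i => ?_
  simpa using hK 0 i

lemma q_ne (q : ℂ) (hq : ‖q‖ < 1) (n : ℕ) : 1 - q * q^n ≠ 0 :=
  sub_ne_zero.2 (small_ne q q hq hq n).symm

/-- q-binomial recursion -/
lemma g_rec (a q x : ℂ) (hq : ‖q‖ < 1) (hx : ‖x‖ < 1) :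
    (1 - x) * ∑' i, gT a q x i = (1 - a*x) * ∑' i, gT a q (x*q) i := by
  have hxq : ‖x*q‖ < 1 := by
    rw [norm_mul]; nlinarith [norm_nonneg x, norm_nonneg q]
  have s1 := (gT_summable a q x hq hx).hasSum.mul_left (1 - x)
  have s2 := (gT_summable a q (x*q) hq hxq).hasSum.mul_left (1 - a*x)
  have s := (s1.sub s2).tendsto_sum_nat
  have key : ∀ n, ∑ i ∈ Finset.range (n+1),
      ((1 - x) * gT a q x i - (1 - a*x) * gT a q (x*q) i) =
      -(1 - a * q^n) * x * gT a q x n := by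
    intro n
    induction n with
    | zero => simp [gT, qp_zero]; ring
    | succ n ih =>
      rw [Finset.sum_range_succ, ih]
      simp only [gT, qp_succ, mul_pow, pow_succ]
      have h1 := q_ne q hq n
      have h2 := qp_ne q q (small_ne q q hq hq) n
      generalize q^n = v at *
      have h3 : 1 - v * q ≠ 0 := by rwa [mul_comm]
      field_simp
      ring
  have hlim : Tendsto (fun n : ℕ => -(1 - a * q^n) * x * gT a q x n) atTop (𝓝 0) := by
    have hp := tendsto_pow_atTop_nhds_zero_of_norm_lt_one hq
    have h0 := (gT_summable a q x hq hx).tendsto_atTop_zero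
    have := (((hp.const_mul a).const_sub 1).neg.mul_const x).mul h0
    simpa using this
  have := tendsto_nhds_unique ((s.comp (tendsto_add_atTop_nat 1)).congr key) hlim
  exact sub_eq_zero.1 this

lemma g_eval (a q x : ℂ) (hq : ‖q‖ < 1) (hx : ‖x‖ < 1) :
    qPochInf x q * ∑' i, gT a q x i = qPochInf (a*x) q := by
  have hn : ∀ n : ℕ, ‖x*q^n‖ ≤ ‖x‖ := fun n => by
    rw [norm_mul, norm_pow]
    exact mul_le_of_le_one_right (norm_nonneg _) (pow_le_one₀ (norm_nonneg _) hq.le)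
  have key : ∀ n, qPoch x q n * ∑' i, gT a q x i = qPoch (a*x) q n * ∑' i, gT a q (x*q^n) i := by
    intro n
    induction n with
    | zero => simp [qp_zero]
    | succ n ih =>
      have := g_rec a q (x*q^n) hq ((hn n).trans_lt hx)
      rw [qp_succ, qp_succ, mul_right_comm, ih, mul_right_comm, mul_assoc,
        this, pow_succ, ← mul_assoc x, ← mul_assoc, ← mul_assoc a]
  have hlim : Tendsto (fun n : ℕ => ∑' i, gT a q (x*q^n) i) atTop (𝓝 (∑' i, gT a q 0 i)) := by
    obtain ⟨K, hK0, hK⟩ := gT_bound a q hq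
    refine tendsto_tsum_of_dominated_convergence
      ((summable_geometric_of_lt_one (norm_nonneg _) hx).mul_left K) (fun i => ?_)
      (Eventually.of_forall fun n i => hK _ _ (hn n) i)
    have hp := (tendsto_pow_atTop_nhds_zero_of_norm_lt_one hq).const_mul x
    rw [mul_zero] at hp
    exact (hp.pow i).const_mul _
  have h0 : ∑' i, gT a q 0 i = 1 := by
    rw [tsum_eq_single 0 (fun i hi => by simp [gT, hi])]
    simp [gT, qp_zero]
  rw [h0] at hlim
  have h1 := (qp_tendsto x q hq).mul_const (∑' i, gT a q x i)
  have h2 := (qp_tendsto (a*x) q hq).mul hlim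
  rw [mul_one] at h2
  exact tendsto_nhds_unique h1 (h2.congr fun n => (key n).symm)

lemma f_rec (a q b : ℂ) (hq : ‖q‖ < 1) (ha : a ≠ 0) (hx : ‖-(q/a)‖ < 1) :
    ∑' i, fT a q (-(q/a)) b i =
      (1 - b*q) * (1 - b*q^2/a^2) * ∑' i, fT a q (-(q/a)) (b*q^2) i := by
  have s1 := (fT_summable a q _ b hq hx).hasSum
  have s2 := (fT_summable a q _ (b*q^2) hq hx).hasSum.mul_left ((1 - b*q) * (1 - b*q^2/a^2))
  have s := (s1.sub s2).tendsto_sum_nat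
  have key : ∀ n, ∑ i ∈ Finset.range (n+1),
      (fT a q (-(q/a)) b i - (1 - b*q) * (1 - b*q^2/a^2) * fT a q (-(q/a)) (b*q^2) i) =
      b * (1 - q/a) * (1 - a*q^n) * (-(q/a)) *
        (gT a q (-(q/a)) n * (qPoch (b*q) q n * qPochInf (b*q/a*q^(n+2)) q)) := by
    intro n
    induction n with
    | zero =>
      have e1 : qPochInf (b*q/a) q = (1 - b*q/a) * ((1 - b*q/a*q) * qPochInf (b*q/a*q^2) q) := by
        rw [qp_inf_succ _ q hq, qp_inf_succ (b*q/a*q) q hq]; ring_nf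
      have e2 : b*q^2*q/a = b*q/a*q^2 := by ring
      simp [fT, gT, qp_zero, e1, e2]
      field_simp
      ring
    | succ n ih =>
      rw [Finset.sum_range_succ, ih]
      have e1 : qPochInf (b*q/a*q^(n+1)) q =
          (1 - b*q/a*q^(n+1)) * ((1 - b*q/a*q^(n+2)) * qPochInf (b*q/a*q^(n+3)) q) := by
        rw [qp_inf_succ _ q hq, qp_inf_succ (b*q/a*q^(n+1)*q) q hq]; ring_nf
      have e3 : qPochInf (b*q/a*q^(n+2)) q =
          (1 - b*q/a*q^(n+2)) * qPochInf (b*q/a*q^(n+3)) q := by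
        rw [qp_inf_succ _ q hq]; ring_nf
      have e2 : b*q^2*q/a*q^(n+1) = b*q/a*q^(n+3) := by ring
      have e4 : (1 - b*q) * qPoch (b*q^2) q (n+1) =
          qPoch (b*q) q n * (1 - b*q*q^n) * (1 - b*q*q^(n+1)) := by
        rw [← qp_succ, ← qp_succ, qp_succ' (b*q)]; ring_nf
      have e5 : qPoch b q (n+1) = (1 - b) * qPoch (b*q) q n := qp_succ' _ _ _
      have e6 : (1 - b*q) * (1 - b*q^2/a^2) * fT a q (-(q/a)) (b*q^2) (n+1) =
        (1 - b*q^2/a^2) * (gT a q (-(q/a)) (n+1) * (qPoch (b*q) q n * (1 - b*q*q^n) *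
          (1 - b*q*q^(n+1)) * qPochInf (b*q/a*q^(n+3)) q)) := by
        rw [← e4, fT, e2]; ring
      have e7 : gT a q (-(q/a)) n * (1 - a*q^n) * (-(q/a)) =
          gT a q (-(q/a)) (n+1) * (1 - q*q^n) := by
        have h1 := q_ne q hq n
        have h2 := qp_ne q q (small_ne q q hq hq) n
        simp only [gT, qp_succ, pow_succ]
        field_simp
      rw [e6, fT, e1, e3, e5, qp_succ (b*q)]
      rw [show b * (1 - q/a) * (1 - a*q^n) * (-(q/a)) *
        (gT a q (-(q/a)) n * (qPoch (b*q) q n * ((1 - b*q/a*q^(n+2)) * qPochInf (b*q/a*q^(n+3)) q)))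
        = b * (1 - q/a) * (gT a q (-(q/a)) n * (1 - a*q^n) * (-(q/a))) * (qPoch (b*q) q n *
        ((1 - b*q/a*q^(n+2)) * qPochInf (b*q/a*q^(n+3)) q)) by ring, e7]
      rw [show n+1+2 = n+3 from rfl]
      generalize qPochInf (b*q/a*q^(n+3)) q = S
      generalize gT a q (-(q/a)) (n+1) = A
      generalize qPoch (b*q) q n = W
      field_simp
      ring
  have hlim : Tendsto (fun n : ℕ => b * (1 - q/a) * (1 - a*q^n) * (-(q/a)) *
        (gT a q (-(q/a)) n * (qPoch (b*q) q n * qPochInf (b*q/a*q^(n+2)) q))) atTop (𝓝 0) := by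
    have hp := tendsto_pow_atTop_nhds_zero_of_norm_lt_one hq
    have h0 := (fT_summable a q (-(q/a)) (b*q) hq hx).tendsto_atTop_zero
    have h1 : Tendsto (fun n : ℕ => (gT a q (-(q/a)) n *
        (qPoch (b*q) q n * qPochInf (b*q/a*q^(n+2)) q))) atTop (𝓝 0) := by
      obtain ⟨K, hK0, hK⟩ := gT_bound a q hq
      have hg := (gT_summable a q _ hq hx).tendsto_atTop_zero
      refine hg.zero_mul_isBoundedUnder_le ?_
      refine isBoundedUnder_of ⟨Real.exp (‖b*q‖ * (1 - ‖q‖)⁻¹) *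
        Real.exp (‖b*q/a‖ * (1 - ‖q‖)⁻¹), fun n => ?_⟩
      have g1 := qp_bound q hq _ (b*q) le_rfl n
      have g2 := qp_inf_bound q hq ‖b*q/a‖ (b*q/a*q^(n+2)) (by
        rw [norm_mul, norm_pow]
        exact mul_le_of_le_one_right (norm_nonneg _) (pow_le_one₀ (norm_nonneg _) hq.le))
      simp only [Function.comp, norm_mul (qPoch _ _ _)]
      gcongr
    have := ((((hp.const_mul a).const_sub 1).const_mul (b * (1 - q/a))).mul_const (-(q/a))).mul h1
    simpa using this
  have := tendsto_nhds_unique ((s.comp (tendsto_add_atTop_nat 1)).congr key) hlim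
  exact sub_eq_zero.1 this

lemma f_eval (a q b : ℂ) (hq : ‖q‖ < 1) (ha : a ≠ 0) (hx : ‖-(q/a)‖ < 1)
    (hc : ∀ j : ℕ, (b * q / a) * q ^ j ≠ 1) :
    ∑' i, fT a q (-(q/a)) b i =
      qPochInf (b*q) (q^2) * qPochInf (b*q^2/a^2) (q^2) * ∑' i, gT a q (-(q/a)) i := by
  have hq2 : ‖q^2‖ < 1 := by rw [norm_pow]; exact pow_lt_one₀ (norm_nonneg _) hq two_ne_zero
  have key : ∀ n : ℕ, qPoch (b*q) (q^2) n * qPoch (b*q^2/a^2) (q^2) n *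
      ∑' i, fT a q (-(q/a)) (b*q^(2*n)) i = ∑' i, fT a q (-(q/a)) b i := by
    intro n
    induction n with
    | zero => simp [qp_zero]
    | succ n ih =>
      rw [← ih, f_rec a q (b*q^(2*n)) hq ha hx, qp_succ, qp_succ,
        show b*q^(2*n)*q^2 = b*q^(2*(n+1)) by ring]
      ring
  have hlim : Tendsto (fun n : ℕ => ∑' i, fT a q (-(q/a)) (b*q^(2*n)) i) atTop
      (𝓝 (∑' i, gT a q (-(q/a)) i)) := by
    obtain ⟨K, hK0, hK⟩ := fT_bound a q (-(q/a)) b hq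
    refine tendsto_tsum_of_dominated_convergence
      ((summable_geometric_of_lt_one (norm_nonneg _) hx).mul_left K) (fun i => ?_)
      (Eventually.of_forall fun n i => hK _ i)
    have h2n : Tendsto (fun n : ℕ => 2*n) atTop atTop :=
      tendsto_atTop_mono (fun n => by simp only [id]; omega) tendsto_id
    have hp := ((tendsto_pow_atTop_nhds_zero_of_norm_lt_one hq).comp h2n).const_mul b
    rw [mul_zero] at hp
    have h1 : Tendsto (fun n : ℕ => qPoch (b*q^(2*n)) q i) atTop (𝓝 1) := by
      have hcont : Continuous fun y : ℂ => qPoch y q i := by unfold qPoch; fun_prop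
      have := (hcont.tendsto 0).comp hp
      simpa [qPoch, Function.comp_def] using this
    have h2 : Tendsto (fun n : ℕ => qPochInf (b*q^(2*n)*q/a*q^i) q) atTop (𝓝 1) := by
      have := (qp_tail _ q hq hc).comp (tendsto_atTop_mono (fun n => by simp only [id]; omega) tendsto_id :
        Tendsto (fun n : ℕ => 2*n+i) atTop atTop)
      refine this.congr fun n => ?_
      simp only [Function.comp]
      ring_nf
    have := (h1.mul h2).const_mul (gT a q (-(q/a)) i)
    simpa [fT] using this
  exact tendsto_nhds_unique (tendsto_const_nhds.congr fun n => (key n).symm)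
    (((qp_tendsto _ _ hq2).mul (qp_tendsto _ _ hq2)).mul hlim)

theorem stmt_2 (q a b : ℂ) (hq : ‖q‖ < 1) (ha : a ≠ 0) (hqa : ‖q / a‖ < 1)
    (hc : ∀ j : ℕ, (b * q / a) * q ^ j ≠ 1) :
    phi a b (b * q / a) q (-(q / a)) =
      qPochInf (-q) q * qPochInf (b * q) (q ^ 2) * qPochInf (b * q ^ 2 / a ^ 2) (q ^ 2) /
        (qPochInf (-(q / a)) q * qPochInf (b * q / a) q) := by
  have hx : ‖-(q/a)‖ < 1 := by rwa [norm_neg]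
  have hC := qp_inf_ne _ q hq hc
  have hX := qp_inf_ne _ q hq (small_ne (-(q/a)) q hq hx)
  have h1 : phi a b (b*q/a) q (-(q/a)) * qPochInf (b*q/a) q = ∑' i, fT a q (-(q/a)) b i := by
    rw [phi, ← tsum_mul_right]
    refine tsum_congr fun i => ?_
    rw [qp_inf_split _ q hq i, fT, gT]
    have g1 := qp_ne _ q hc i
    have g2 := qp_ne q q (small_ne q q hq hq) i
    generalize qPoch (b*q/a) q i = z at *
    generalize qPochInf (b*q/a*q^i) q = y at *
    generalize (-(q/a))^i = w at *
    field_simp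
  have h2 := g_eval a q _ hq hx
  rw [show a * -(q/a) = -q by field_simp] at h2
  rw [f_eval a q b hq ha hx hc] at h1
  rw [eq_div_iff (mul_ne_zero hX hC), ← h2]
  linear_combination qPochInf (-(q/a)) q * h1
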